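/- Let F be a face of σ^∨, let z ∈ F[1] ∩ ℤ^n, and let w ∈ F ∩ ℤ^n satisfy ⟨u_ρ, w⟩ > 0 for every ray ρ of σ with u_ρ ∉ F^⊥ (i.e. w lies in the relative interior of F). Then there exists a positive integer c such that cw + z ∈ P_K and cw − z ∈ P_{−K}; consequently the monomial χ^{2cw} lies in tr(ω) but not in p_F. -/

import Mathlib

set_option synthInstance.maxHeartbeats 1000000
set_option maxHeartbeats 1000000

noncomputable section

variable {α : Type} [Fintype α]

/-- pairing of an integer vector with a real vector -/
def ipair (u : α → ℤ) (x : α → ℝ) : ℝ := ∑ j, (u j : ℝ) * x j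

/-- pairing of two integer vectors -/
def zpair (u m : α → ℤ) : ℤ := ∑ j, u j * m j

/-- pairing of two real vectors -/
def rpair (u x : α → ℝ) : ℝ := ∑ j, u j * x j

/-- the real vector associated to an integer vector -/
def toReal (m : α → ℤ) : α → ℝ := fun j => (m j : ℝ)

variable {ι : Type} [Fintype ι]

/-- the cone `σ` generated by the integer vectors `u i` -/
def genCone (u : ι → α → ℤ) : Set (α → ℝ) :=
  {x | ∃ c : ι → ℝ, (∀ i, 0 ≤ c i) ∧ x = ∑ i, c i • toReal (u i)}

/-- the dual cone `σ^∨` of the cone generated by the `u i` -/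
def dualCone (u : ι → α → ℤ) : Set (α → ℝ) := {x | ∀ i, 0 ≤ ipair (u i) x}

/-- the polyhedron `P_K` -/
def PK (u : ι → α → ℤ) : Set (α → ℝ) := {x | ∀ i, 1 ≤ ipair (u i) x}

/-- the polyhedron `P_{-K}` -/
def PmK (u : ι → α → ℤ) : Set (α → ℝ) := {x | ∀ i, (-1 : ℝ) ≤ ipair (u i) x}

/-- the cone generated by `u` is pointed -/
def IsPointed (u : ι → α → ℤ) : Prop := ∀ x ∈ genCone u, -x ∈ genCone u → x = 0

/-- an integer vector is primitive if the gcd of its coordinates is a unit -/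
def Primitive (m : α → ℤ) : Prop := IsUnit (Finset.univ.gcd m)

/-- the ray spanned by an integer vector -/
def ray (v : α → ℤ) : Set (α → ℝ) := {x | ∃ t : ℝ, 0 ≤ t ∧ x = t • toReal v}

/-- `u` lists exactly the primitive ray generators of the rational pointed cone `σ` that it
generates: `σ` is pointed, each `u i` is primitive, and each `u i` spans an extreme ray of `σ`. -/
def IsRaySetup (u : ι → α → ℤ) : Prop :=
  IsPointed u ∧ (∀ i, Primitive (u i)) ∧ ∀ i, IsExtreme ℝ (genCone u) (ray (u i))

variable (k : Type) [Field k]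

/-- the monomial `χ^m` in the Laurent polynomial ring `k[ℤ^α]` -/
def mono (m : α → ℤ) : AddMonoidAlgebra k (α → ℤ) := AddMonoidAlgebra.single m 1

/-- the toric ring `R = k[σ^∨ ∩ M]`, the subalgebra of `k[ℤ^α]` spanned by the monomials
`χ^m` with `m ∈ σ^∨ ∩ M` -/
def toricRing (u : ι → α → ℤ) : Subalgebra k (AddMonoidAlgebra k (α → ℤ)) :=
  Algebra.adjoin k {f | ∃ m : α → ℤ, toReal m ∈ dualCone u ∧ f = mono k m}

/-- the canonical module `ω`, the `R`-submodule of `k[ℤ^α]` spanned by the monomials `χ^m`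
with `m ∈ P_K ∩ M` -/
def canMod (u : ι → α → ℤ) : Submodule ↥(toricRing k u) (AddMonoidAlgebra k (α → ℤ)) :=
  Submodule.span ↥(toricRing k u) {f | ∃ m : α → ℤ, toReal m ∈ PK u ∧ f = mono k m}

/-- the trace ideal `tr(ω)` of the canonical module -/
def traceIdeal (u : ι → α → ℤ) : Ideal ↥(toricRing k u) :=
  Ideal.span {r | ∃ (φ : ↥(canMod k u) →ₗ[↥(toricRing k u)] ↥(toricRing k u))
    (x : ↥(canMod k u)), φ x = r}

/-- a face `F` of the dual cone `σ^∨`: the intersection of `σ^∨` with the hyperplane orthogonal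
to a supporting vector `w ∈ σ` -/
def IsFaceOfDual (u : ι → α → ℤ) (F : Set (α → ℝ)) : Prop :=
  ∃ w ∈ genCone u, F = {x ∈ dualCone u | rpair w x = 0}

/-- the graded prime ideal `p_F` associated to a face `F` of `σ^∨`, generated by the monomials
`χ^m` with `m ∈ (σ^∨ ∩ M) \ F` -/
def facePrime (u : ι → α → ℤ) (F : Set (α → ℝ)) : Ideal ↥(toricRing k u) :=
  Ideal.span {r | ∃ m : α → ℤ, toReal m ∈ dualCone u ∧ toReal m ∉ F ∧
    (r : AddMonoidAlgebra k (α → ℤ)) = mono k m}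

/-- `F[1]`: the intersection of all facet-defining hyperplanes containing `F`, translated by one
lattice length into the interior of `σ^∨` -/
def faceShift (u : ι → α → ℤ) (F : Set (α → ℝ)) : Set (α → ℝ) :=
  {x | ∀ i, (∀ y ∈ F, ipair (u i) y = 0) → ipair (u i) x = 1}

end

section Pairing

variable {α ι : Type}

lemma toReal_add (a b : α → ℤ) : toReal (a + b) = toReal a + toReal b := by
  ext j; simp [toReal]

lemma toReal_nsmul (c : ℕ) (a : α → ℤ) : toReal (c • a) = (c : ℝ) • toReal a := by
  ext j; simp [toReal]

variable [Fintype α]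

lemma ipair_toReal (v m : α → ℤ) : ipair v (toReal m) = (zpair v m : ℝ) := by
  simp [ipair, zpair, toReal]

lemma ipair_add (v : α → ℤ) (x y : α → ℝ) : ipair v (x + y) = ipair v x + ipair v y := by
  simp [ipair, mul_add, Finset.sum_add_distrib]

lemma ipair_smul (v : α → ℤ) (c : ℝ) (x : α → ℝ) : ipair v (c • x) = c * ipair v x := by
  simp only [ipair, Finset.mul_sum, Pi.smul_apply, smul_eq_mul]
  exact Finset.sum_congr rfl fun j _ => by ring

lemma rpair_add (v x y : α → ℝ) : rpair v (x + y) = rpair v x + rpair v y := by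
  simp [rpair, mul_add, Finset.sum_add_distrib]

lemma rpair_smul (v : α → ℝ) (c : ℝ) (x : α → ℝ) : rpair v (c • x) = c * rpair v x := by
  simp only [rpair, Finset.mul_sum, Pi.smul_apply, smul_eq_mul]
  exact Finset.sum_congr rfl fun j _ => by ring

lemma zpair_add (v a b : α → ℤ) : zpair v (a + b) = zpair v a + zpair v b := by
  simp [zpair, mul_add, Finset.sum_add_distrib]

lemma zpair_sub (v a b : α → ℤ) : zpair v (a - b) = zpair v a - zpair v b := by
  simp [zpair, mul_sub, Finset.sum_sub_distrib]

lemma zpair_nsmul (v : α → ℤ) (c : ℕ) (a : α → ℤ) : zpair v (c • a) = c * zpair v a := by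
  simp only [zpair, Finset.mul_sum, Pi.smul_apply, nsmul_eq_mul]
  exact Finset.sum_congr rfl fun j _ => by ring

lemma toReal_mem_PK {u : ι → α → ℤ} {m : α → ℤ} :
    toReal m ∈ PK u ↔ ∀ i, 1 ≤ zpair (u i) m := by
  simp only [PK, Set.mem_ofPred_eq, ipair_toReal]
  exact forall_congr' fun i => by exact_mod_cast Iff.rfl

lemma toReal_mem_PmK {u : ι → α → ℤ} {m : α → ℤ} :
    toReal m ∈ PmK u ↔ ∀ i, -1 ≤ zpair (u i) m := by
  simp only [PmK, Set.mem_ofPred_eq, ipair_toReal]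
  exact forall_congr' fun i => by exact_mod_cast Iff.rfl

lemma zero_mem_dualCone (u : ι → α → ℤ) : (0 : α → ℝ) ∈ dualCone u := by
  intro i; simp [ipair]

lemma add_mem_dualCone {u : ι → α → ℤ} {x y : α → ℝ} (hx : x ∈ dualCone u)
    (hy : y ∈ dualCone u) : x + y ∈ dualCone u := by
  intro i
  rw [ipair_add]
  exact add_nonneg (hx i) (hy i)

lemma add_mem_dualCone_of_PK_of_PmK {u : ι → α → ℤ} {x y : α → ℝ} (hx : x ∈ PK u)
    (hy : y ∈ PmK u) : x + y ∈ dualCone u := by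
  intro i
  have h₁ : 1 ≤ ipair (u i) x := hx i
  have h₂ : -1 ≤ ipair (u i) y := hy i
  rw [ipair_add]
  linarith

variable [Fintype ι]

lemma rpair_nonneg {u : ι → α → ℤ} {v x : α → ℝ} (hv : v ∈ genCone u) (hx : x ∈ dualCone u) :
    0 ≤ rpair v x := by
  obtain ⟨c, hc, rfl⟩ := hv
  have h : rpair (∑ i, c i • toReal (u i)) x = ∑ i, c i * ipair (u i) x := by
    simp only [rpair, ipair, toReal, Finset.sum_apply, Pi.smul_apply, smul_eq_mul,
      Finset.sum_mul, Finset.mul_sum]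
    rw [Finset.sum_comm]
    exact Finset.sum_congr rfl fun i _ => Finset.sum_congr rfl fun j _ => by ring
  rw [h]
  exact Finset.sum_nonneg fun i _ => mul_nonneg (hc i) (hx i)

namespace IsFaceOfDual

variable {u : ι → α → ℤ} {F : Set (α → ℝ)}

lemma subset_dualCone (hF : IsFaceOfDual u F) : F ⊆ dualCone u := by
  obtain ⟨v, -, rfl⟩ := hF
  exact fun x hx => hx.1

lemma smul_mem (hF : IsFaceOfDual u F) {c : ℝ} (hc : 0 ≤ c) {x : α → ℝ} (hx : x ∈ F) :
    c • x ∈ F := by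
  obtain ⟨v, -, rfl⟩ := hF
  refine ⟨fun i => ?_, ?_⟩
  · rw [ipair_smul]
    exact mul_nonneg hc (hx.1 i)
  · rw [rpair_smul, hx.2, mul_zero]

lemma right_mem_of_add_mem (hF : IsFaceOfDual u F) {x y : α → ℝ} (hx : x ∈ dualCone u)
    (hy : y ∈ dualCone u) (hxy : x + y ∈ F) : y ∈ F := by
  obtain ⟨v, hv, rfl⟩ := hF
  refine ⟨hy, ?_⟩
  have h := hxy.2
  rw [rpair_add] at h
  linarith [rpair_nonneg hv hx, rpair_nonneg hv hy]

end IsFaceOfDual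

end Pairing

section Monomials

variable {α : Type} (k : Type) [Field k]

lemma mono_mul_mono (a b : α → ℤ) : mono k a * mono k b = mono k (a + b) := by
  simp [mono, AddMonoidAlgebra.single_mul_single]

variable {k}

lemma mem_support_mono {a m : α → ℤ} (hm : m ∈ (mono k a).coeff.support) : m = a := by
  simpa [mono, Finsupp.single_apply, eq_comm] using hm

lemma self_mem_support_mono (a : α → ℤ) : a ∈ (mono k a).coeff.support := by
  simp [mono]

lemma exists_add_of_mem_support_mul {f g : AddMonoidAlgebra k (α → ℤ)} {m : α → ℤ}
    (hm : m ∈ (f * g).coeff.support) :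
    ∃ a ∈ f.coeff.support, ∃ b ∈ g.coeff.support, a + b = m := by
  classical
  exact Finset.mem_add.1 (AddMonoidAlgebra.support_coeff_mul_subset f g hm)

lemma mem_support_or_of_mem_support_add {f g : AddMonoidAlgebra k (α → ℤ)} {m : α → ℤ}
    (hm : m ∈ (f + g).coeff.support) : m ∈ f.coeff.support ∨ m ∈ g.coeff.support := by
  classical
  rw [AddMonoidAlgebra.coeff_add] at hm
  exact Finset.mem_union.1 (Finsupp.support_add hm)

end Monomials

section Toric

variable {α ι : Type} [Fintype α] {k : Type} [Field k] {u : ι → α → ℤ}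

lemma mono_mem_toricRing {m : α → ℤ} (hm : toReal m ∈ dualCone u) : mono k m ∈ toricRing k u :=
  Algebra.subset_adjoin ⟨m, hm, rfl⟩

lemma toReal_mem_dualCone_of_mem_support {f : AddMonoidAlgebra k (α → ℤ)}
    (hf : f ∈ toricRing k u) {m : α → ℤ} (hm : m ∈ f.coeff.support) :
    toReal m ∈ dualCone u := by
  induction hf using Algebra.adjoin_induction generalizing m with
  | mem f hf =>
    obtain ⟨a, ha, rfl⟩ := hf
    rwa [mem_support_mono hm]
  | algebraMap r =>
    have h : m = 0 := by
      by_contra h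
      simp [AddMonoidAlgebra.coe_algebraMap, Ne.symm h] at hm
    subst h
    convert zero_mem_dualCone u
    ext j
    simp [toReal]
  | add f g _ _ ihf ihg => exact (mem_support_or_of_mem_support_add hm).elim ihf ihg
  | mul f g _ _ ihf ihg =>
    obtain ⟨a, ha, b, hb, rfl⟩ := exists_add_of_mem_support_mul hm
    rw [toReal_add]
    exact add_mem_dualCone (ihf ha) (ihg hb)

lemma toReal_notMem_face_of_mem_support [Fintype ι] {F : Set (α → ℝ)} (hF : IsFaceOfDual u F)
    {r : toricRing k u} (hr : r ∈ facePrime k u F) {m : α → ℤ}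
    (hm : m ∈ (r : AddMonoidAlgebra k (α → ℤ)).coeff.support) : toReal m ∉ F := by
  induction hr using Submodule.span_induction generalizing m with
  | mem r hr =>
    obtain ⟨a, -, haF, hra⟩ := hr
    rw [hra] at hm
    rwa [mem_support_mono hm]
  | zero => simp at hm
  | add r s _ _ ihr ihs => exact (mem_support_or_of_mem_support_add hm).elim ihr ihs
  | smul s r _ ih =>
    obtain ⟨a, ha, b, hb, rfl⟩ := exists_add_of_mem_support_mul hm
    rw [toReal_add]
    exact fun h => ih hb (hF.right_mem_of_add_mem
      (toReal_mem_dualCone_of_mem_support s.2 ha) (toReal_mem_dualCone_of_mem_support r.2 hb) h)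

lemma mono_notMem_facePrime [Fintype ι] {F : Set (α → ℝ)} (hF : IsFaceOfDual u F) {r : toricRing k u}
    {m : α → ℤ} (hr : (r : AddMonoidAlgebra k (α → ℤ)) = mono k m) (hm : toReal m ∈ F) :
    r ∉ facePrime k u F := fun h =>
  toReal_notMem_face_of_mem_support hF h (hr ▸ self_mem_support_mono m) hm

lemma mul_mono_mem_toricRing {b : α → ℤ} (hb : toReal b ∈ PmK u)
    {f : AddMonoidAlgebra k (α → ℤ)} (hf : f ∈ canMod k u) : f * mono k b ∈ toricRing k u := by
  induction hf using Submodule.span_induction with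
  | mem f hf =>
    obtain ⟨a, ha, rfl⟩ := hf
    rw [mono_mul_mono]
    apply mono_mem_toricRing
    rw [toReal_add]
    exact add_mem_dualCone_of_PK_of_PmK ha hb
  | zero => rw [zero_mul]; exact zero_mem _
  | add f g _ _ ihf ihg => rw [add_mul]; exact add_mem ihf ihg
  | smul s f _ ih =>
    rw [Algebra.smul_def, mul_assoc]
    exact mul_mem s.2 ih

/-- Multiplication by `χ^b` with `b ∈ P_{-K}`, as a homomorphism from `ω` to `R`. -/
noncomputable def canModMulMono (b : α → ℤ) (hb : toReal b ∈ PmK u) :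
    canMod k u →ₗ[toricRing k u] toricRing k u where
  toFun f := ⟨f * mono k b, mul_mono_mem_toricRing hb f.2⟩
  map_add' _ _ := Subtype.ext (add_mul _ _ _)
  map_smul' _ _ := Subtype.ext (mul_assoc _ _ _)

lemma mono_add_mem_traceIdeal {a b : α → ℤ} (ha : toReal a ∈ PK u) (hb : toReal b ∈ PmK u)
    {r : toricRing k u} (hr : (r : AddMonoidAlgebra k (α → ℤ)) = mono k (a + b)) :
    r ∈ traceIdeal k u := by
  refine Ideal.subset_span
    ⟨canModMulMono b hb, ⟨mono k a, Submodule.subset_span ⟨a, ha, rfl⟩⟩, Subtype.ext ?_⟩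
  rw [hr, ← mono_mul_mono]
  rfl

/-- A large multiple of a lattice point in the relative interior of `F` moves a lattice point of
`F[1]` into `P_K`, and its negative into `P_{-K}`. -/
lemma exists_nsmul_add_mem_PK_and_nsmul_sub_mem_PmK [Fintype ι] {F : Set (α → ℝ)} {z w : α → ℤ}
    (hz : toReal z ∈ faceShift u F) (hw : toReal w ∈ F)
    (hwpos : ∀ i, ¬ (∀ y ∈ F, ipair (u i) y = 0) → 0 < zpair (u i) w) :
    ∃ c : ℕ, 0 < c ∧ toReal (c • w + z) ∈ PK u ∧ toReal (c • w - z) ∈ PmK u := by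
  obtain ⟨c, hc⟩ : ∃ c : ℕ, ∀ i, (zpair (u i) z).natAbs ≤ c :=
    ⟨∑ i, (zpair (u i) z).natAbs, fun i =>
      Finset.single_le_sum (f := fun i => (zpair (u i) z).natAbs)
        (fun _ _ => Nat.zero_le _) (Finset.mem_univ i)⟩
  have key (i : ι) : (zpair (u i) w = 0 ∧ zpair (u i) z = 1) ∨
      |zpair (u i) z| + 1 ≤ ((c + 1 : ℕ) : ℤ) * zpair (u i) w := by
    by_cases h : ∀ y ∈ F, ipair (u i) y = 0
    · have h₁ := h _ hw
      have h₂ := hz i h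
      rw [ipair_toReal] at h₁ h₂
      exact .inl ⟨by exact_mod_cast h₁, by exact_mod_cast h₂⟩
    · have h₁ := hwpos i h
      have h₂ := hc i
      refine .inr ?_
      have h₃ : |zpair (u i) z| ≤ c := by
        rw [Int.abs_eq_natAbs]
        exact_mod_cast h₂
      push_cast
      nlinarith
  refine ⟨c + 1, c.succ_pos, toReal_mem_PK.2 fun i => ?_, toReal_mem_PmK.2 fun i => ?_⟩
  · rw [zpair_add, zpair_nsmul]
    obtain ⟨h₁, h₂⟩ | h := key i
    · simp [h₁, h₂]
    · linarith [neg_abs_le (zpair (u i) z)]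
  · rw [zpair_sub, zpair_nsmul]
    obtain ⟨h₁, h₂⟩ | h := key i
    · simp [h₁, h₂]
    · linarith [le_abs_self (zpair (u i) z)]

end Toric

/-- Let `F` be a face of `σ^∨`, `z ∈ F[1] ∩ ℤ^n`, and let `w ∈ F ∩ ℤ^n`
pair strictly positively with every primitive ray generator `u_ρ ∉ F^⊥` (i.e. `w` lies in the
relative interior of `F`).  Then for some positive integer `c` we have `c•w + z ∈ P_K` and
`c•w - z ∈ P_{-K}`; consequently `χ^{2c•w}` lies in `tr(ω)` but not in `p_F`. -/
theorem relint_mul_shift_in_trace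
    {n : ℕ} {ι : Type} [Fintype ι] (u : ι → Fin n → ℤ) (hu : IsRaySetup u)
    (k : Type) [Field k] [IsAlgClosed k] [CharZero k]
    (F : Set (Fin n → ℝ)) (hF : IsFaceOfDual u F)
    (z : Fin n → ℤ) (hz : toReal z ∈ faceShift u F)
    (w : Fin n → ℤ) (hw : toReal w ∈ F)
    (hwpos : ∀ i, ¬ (∀ y ∈ F, ipair (u i) y = 0) → 0 < zpair (u i) w) :
    ∃ c : ℕ, 0 < c ∧
      toReal (c • w + z) ∈ PK u ∧
      toReal (c • w - z) ∈ PmK u ∧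
      ∃ r : ↥(toricRing k u),
        (r : AddMonoidAlgebra k (Fin n → ℤ)) = mono k ((2 * c) • w) ∧
        r ∈ traceIdeal k u ∧ r ∉ facePrime k u F := by
  obtain ⟨c, hc, hadd, hsub⟩ := exists_nsmul_add_mem_PK_and_nsmul_sub_mem_PmK hz hw hwpos
  have hmem : toReal ((2 * c) • w) ∈ F := by
    rw [toReal_nsmul]
    exact hF.smul_mem (Nat.cast_nonneg _) hw
  have hsum : (2 * c) • w = (c • w + z) + (c • w - z) := by
    rw [add_add_sub_cancel, two_mul, add_nsmul]
  exact ⟨c, hc, hadd, hsub,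
    ⟨mono k ((2 * c) • w), mono_mem_toricRing (hF.subset_dualCone hmem)⟩, rfl,
    mono_add_mem_traceIdeal hadd hsub (congrArg (mono k) hsum), mono_notMem_facePrime hF rfl hmem⟩
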